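/- For every n × n matrix A with nonnegative real entries, sm(A) ≤ pm(A) ≤ n·(n!)^{−1/n}·sm(A), where sm is the scaling mean and pm is the permanental mean. -/

import Mathlib

open scoped BigOperators Kronecker
open Matrix

/-- The permanent of a square real matrix. -/
noncomputable def perm {ι : Type*} [Fintype ι] [DecidableEq ι] (A : Matrix ι ι ℝ) : ℝ :=
  ∑ σ : Equiv.Perm ι, ∏ i, A i (σ i)

/-- The permanental mean `pm A = (per A / n!) ^ (1/n)`. -/
noncomputable def pm {ι : Type*} [Fintype ι] [DecidableEq ι] (A : Matrix ι ι ℝ) : ℝ :=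
  (perm A / (Nat.factorial (Fintype.card ι) : ℝ)) ^ ((Fintype.card ι : ℝ)⁻¹)

/-- The geometric mean of the entries of a vector. -/
noncomputable def gmVec {ι : Type*} [Fintype ι] (v : ι → ℝ) : ℝ :=
  (∏ i, v i) ^ ((Fintype.card ι : ℝ)⁻¹)

/-- The set of values whose infimum defines the scaling mean. -/
noncomputable def smSet {ι κ : Type*} [Fintype ι] [Fintype κ] (A : Matrix ι κ ℝ) : Set ℝ :=
  {r : ℝ | ∃ x : ι → ℝ, ∃ y : κ → ℝ, (∀ i, 0 < x i) ∧ (∀ j, 0 < y j) ∧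
    r = (∑ i, ∑ j, x i * A i j * y j) / (gmVec x * gmVec y)}

/-- The scaling mean `sm A = (1/(mn)) · inf over positive vectors x, y of xᵀAy/(gm x · gm y)`. -/
noncomputable def sm {ι κ : Type*} [Fintype ι] [Fintype κ] (A : Matrix ι κ ℝ) : ℝ :=
  ((Fintype.card ι : ℝ) * (Fintype.card κ : ℝ))⁻¹ * sInf (smSet A)


theorem multiset_prod_le_exp (m : ℝ) (hm : 0 < m) (s : Multiset ℝ) (hs : ∀ a ∈ s, 0 ≤ a) :
    s.prod ≤ m ^ (Multiset.card s) * Real.exp (s.sum / m - Multiset.card s) := by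
  induction s using Multiset.induction_on with
  | empty => simp
  | cons a s ih =>
    have h1 := ih (fun b hb => hs b (Multiset.mem_cons_of_mem hb))
    have ha := hs a (Multiset.mem_cons_self a s)
    have h2 : a ≤ m * Real.exp (a / m - 1) := by
      have := Real.add_one_le_exp (a / m - 1)
      have h3 : a / m ≤ Real.exp (a / m - 1) := by linarith
      rw [div_le_iff₀ hm] at h3
      linarith
    rw [Multiset.prod_cons, Multiset.card_cons, Multiset.sum_cons]
    have h0 : 0 ≤ s.prod := Multiset.prod_nonneg (fun b hb => hs b (Multiset.mem_cons_of_mem hb))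
    calc a * s.prod ≤ (m * Real.exp (a / m - 1)) *
          (m ^ (Multiset.card s) * Real.exp (s.sum / m - Multiset.card s)) :=
          mul_le_mul h2 h1 h0 (by positivity)
      _ = _ := by
        have : (a + s.sum) / m - ((Multiset.card s + 1 : ℕ) : ℝ)
          = (a / m - 1) + (s.sum / m - Multiset.card s) := by push_cast; ring
        rw [this, Real.exp_add]; ring

theorem multiset_amgm (s : Multiset ℝ) (hs : ∀ a ∈ s, 0 ≤ a) (m : ℝ) (hm : 0 < m)
    (h : s.sum = Multiset.card s * m) : s.prod ≤ m ^ (Multiset.card s) := by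
  have := multiset_prod_le_exp m hm s hs
  rw [h, mul_div_assoc, div_self hm.ne', mul_one, sub_self, Real.exp_zero, mul_one] at this
  exact this

theorem uni_bound (q : Polynomial ℂ) (K : ℕ) (hK : 0 < K) (hd : q.natDegree ≤ K)
    (q0 : ℝ) (hq0 : 0 < q0) (h0 : q.eval 0 = (q0 : ℂ))
    (hr : ∀ r, q.eval r = 0 → r.re < 0 ∧ r.im = 0) :
    ∃ σ : ℝ, 0 ≤ σ ∧ q.coeff 1 = ((q0 * σ : ℝ) : ℂ) ∧
      ∀ t : ℝ, 0 ≤ t → (q.eval (t : ℂ)).re ≤ q0 * (1 + t * σ / K) ^ K := by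
  have hne : q.eval 0 ≠ 0 := by rw [h0]; exact_mod_cast hq0.ne'
  have hq : q ≠ 0 := by rintro rfl; simp at hne
  have hsp : q.Splits := IsAlgClosed.splits q
  obtain ⟨S, hS, hSpos⟩ : ∃ S : Multiset ℝ, q.roots = S.map (fun s : ℝ => (-(s : ℂ))) ∧
      ∀ s ∈ S, 0 < s := by
    refine ⟨q.roots.map (fun r => -r.re), ?_, ?_⟩
    · rw [Multiset.map_map]
      conv_lhs => rw [← Multiset.map_id q.roots]
      refine Multiset.map_congr rfl (fun r hr' => ?_)
      have := hr r ((Polynomial.mem_roots hq).1 hr')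
      apply Complex.ext <;> simp [this.2]
    · intro s hs
      obtain ⟨r, hr', rfl⟩ := Multiset.mem_map.1 hs
      have := hr r ((Polynomial.mem_roots hq).1 hr')
      linarith [this.1]
  have hcard : Multiset.card S ≤ K := by
    have := Polynomial.card_roots' q
    rw [hS, Multiset.card_map] at this
    omega
  have hev : ∀ t : ℝ, q.eval (t : ℂ) = ((q0 * (S.map (fun s => 1 + t / s)).prod : ℝ) : ℂ) := by
    intro t
    have e0 := hsp.eval_eq_prod_roots 0
    have e1 := hsp.eval_eq_prod_roots (t : ℂ)
    rw [h0] at e0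
    rw [hS, Multiset.map_map] at e0 e1
    rw [e1]
    push_cast
    rw [e0, mul_assoc]
    congr 1
    have : ∀ T : Multiset ℝ, (∀ s ∈ T, 0 < s) →
      (T.map ((fun a : ℂ => (t : ℂ) - a) ∘ fun s : ℝ => -(s : ℂ))).prod =
      (T.map ((fun a : ℂ => (0 : ℂ) - a) ∘ fun s : ℝ => -(s : ℂ))).prod *
        (((T.map (fun s => 1 + t / s)).prod : ℝ) : ℂ) := by
      intro T
      induction T using Multiset.induction_on with
      | empty => simp
      | cons a T ih =>
        intro hT
        have hT' := ih (fun b hb => hT b (Multiset.mem_cons_of_mem hb))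
        have ha : (a : ℂ) ≠ 0 := by exact_mod_cast (hT a (Multiset.mem_cons_self a T)).ne'
        rw [Multiset.map_cons, Multiset.prod_cons, hT', Multiset.map_cons, Multiset.prod_cons,
          Multiset.map_cons, Multiset.prod_cons, Complex.ofReal_mul]
        have : ((fun a : ℂ => (t : ℂ) - a) ∘ fun s : ℝ => -(s : ℂ)) a =
            ((fun a : ℂ => (0 : ℂ) - a) ∘ fun s : ℝ => -(s : ℂ)) a * ((1 + t / a : ℝ) : ℂ) := by
          simp only [Function.comp]
          push_cast
          field_simp
          ring
        rw [this]
        ring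
    exact this S hSpos
  refine ⟨(S.map (fun s => 1 / s)).sum, ?_, ?_, ?_⟩
  · apply Multiset.sum_nonneg
    intro x hx
    obtain ⟨s, hs, rfl⟩ := Multiset.mem_map.1 hx
    have := hSpos s hs
    positivity
  · have h1 := hsp.eval_derivative_eq_eval_mul_sum hne
    have h2 : q.derivative.eval 0 = q.coeff 1 := by
      rw [← Polynomial.coeff_zero_eq_eval_zero, Polynomial.coeff_derivative]; simp
    rw [h2, hS, Multiset.map_map, h0] at h1
    rw [h1]
    push_cast
    congr 1
    have : ∀ T : Multiset ℝ, 
      (T.map ((fun z : ℂ => 1 / ((0 : ℂ) - z)) ∘ fun s : ℝ => -(s : ℂ))).sum =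
        (((T.map (fun s => 1 / s)).sum : ℝ) : ℂ) := by
      intro T
      induction T using Multiset.induction_on with
      | empty => simp
      | cons a T ih =>
        rw [Multiset.map_cons, Multiset.sum_cons, ih, Multiset.map_cons, Multiset.sum_cons]
        simp
    exact this S
  · intro t ht
    rw [hev t, Complex.ofReal_re]
    refine mul_le_mul_of_nonneg_left ?_ hq0.le
    set σ := (S.map (fun s => 1 / s)).sum with hσ
    have hσ0 : 0 ≤ σ := by
      apply Multiset.sum_nonneg
      intro x hx
      obtain ⟨s, hs, rfl⟩ := Multiset.mem_map.1 hx
      have := hSpos s hs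
      positivity
    have hsum : ∀ T : Multiset ℝ, (T.map (fun s => 1 + t / s)).sum =
        Multiset.card T + t * (T.map (fun s => 1 / s)).sum := by
      intro T
      induction T using Multiset.induction_on with
      | empty => simp
      | cons a T ih =>
        simp only [Multiset.map_cons, Multiset.sum_cons, ih, Multiset.card_cons]
        push_cast
        ring
    have hm := multiset_amgm (S.map (fun s => 1 + t / s) + Multiset.replicate (K - Multiset.card S) 1)
      (by
        intro a ha
        rcases Multiset.mem_add.1 ha with ha | ha
        · obtain ⟨s, hs, rfl⟩ := Multiset.mem_map.1 ha
          have := hSpos s hs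
          positivity
        · rw [Multiset.eq_of_mem_replicate ha]; norm_num) (1 + t * σ / K) (by positivity)
      (by
        have hK' : (K : ℝ) ≠ 0 := by positivity
        simp only [Multiset.sum_add, hsum, Multiset.sum_replicate, Multiset.card_add,
          Multiset.card_map, Multiset.card_replicate, nsmul_eq_mul]
        rw [← hσ, Nat.add_sub_cancel' hcard, Nat.cast_sub hcard]
        field_simp
        ring)
    simpa [Nat.add_sub_cancel' hcard] using hm

/-- Coordinates are zero or in the open right half plane, not all zero. -/
def InD {k : ℕ} (z : Fin k → ℂ) : Prop := (∀ i, z i = 0 ∨ 0 < (z i).re) ∧ z ≠ 0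

theorem eval_smul_homog {k d : ℕ} (p : MvPolynomial (Fin k) ℂ) (hp : p.IsHomogeneous d)
    (w : ℂ) (z : Fin k → ℂ) :
    MvPolynomial.eval (fun i => w * z i) p = w ^ d * MvPolynomial.eval z p := by
  rw [MvPolynomial.eval_eq, MvPolynomial.eval_eq, Finset.mul_sum]
  refine Finset.sum_congr rfl (fun m hm => ?_)
  have h1 : ∑ i ∈ m.support, m i = d := (hp.degree_eq_sum_deg_support hm).symm
  simp only [mul_pow, Finset.prod_mul_distrib]
  rw [Finset.prod_pow_eq_pow_sum, h1]
  ring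

theorem ne_of_rot {k d : ℕ} (p : MvPolynomial (Fin k) ℂ) (hp : p.IsHomogeneous d)
    (hD : ∀ z, InD z → MvPolynomial.eval z p ≠ 0) (w : ℂ) (z : Fin k → ℂ)
    (h : InD (fun i => w * z i)) : MvPolynomial.eval z p ≠ 0 := by
  have := hD _ h
  rw [eval_smul_homog p hp] at this
  exact right_ne_zero_of_mul this

theorem inD_cons_zero {k : ℕ} {z : Fin k → ℂ} (h : InD z) :
    InD (Fin.cons 0 z : Fin (k + 1) → ℂ) := by
  refine ⟨fun i => ?_, fun h0 => h.2 ?_⟩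
  · refine Fin.cases ?_ (fun j => ?_) i
    · simp
    · simpa using h.1 j
  · funext j
    have := congrFun h0 j.succ
    simpa using this

theorem inD_cons {k : ℕ} {z : Fin k → ℂ} {t : ℂ} (h : ∀ i, z i = 0 ∨ 0 < (z i).re)
    (ht : 0 < t.re) :
    InD (Fin.cons t z : Fin (k + 1) → ℂ) := by
  refine ⟨fun i => ?_, fun h0 => ?_⟩
  · refine Fin.cases ?_ (fun j => ?_) i
    · simp [ht]
    · simpa using h j
  · have := congrFun h0 0
    simp at this
    simp [this] at ht

theorem mul_cons {k : ℕ} (w t : ℂ) (z : Fin k → ℂ) :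
    (fun i => w * (Fin.cons t z : Fin (k + 1) → ℂ) i) = Fin.cons (w * t) (fun i => w * z i) := by
  funext i
  refine Fin.cases ?_ (fun j => ?_) i <;> simp

/-- roots have negative real part -/
theorem root_re_neg {k d : ℕ} (p : MvPolynomial (Fin (k + 1)) ℂ) (hp : p.IsHomogeneous d)
    (hD : ∀ z, InD z → MvPolynomial.eval z p ≠ 0) (z : Fin k → ℂ) (hz : InD z) (t : ℂ)
    (ht : MvPolynomial.eval (Fin.cons t z : Fin (k + 1) → ℂ) p = 0) : t.re < 0 := by
  by_contra hcon
  push Not at hcon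
  by_cases ht0 : t = 0
  · subst ht0
    exact hD _ (inD_cons_zero hz) ht
  -- rotate a little
  have h1 : ∀ i, ∀ᶠ ε : ℝ in nhdsWithin 0 (Set.Ioi 0),
      (((1 : ℂ) + ε * (starRingEnd ℂ t)) * z i = 0 ∨
        0 < (((1 : ℂ) + ε * (starRingEnd ℂ t)) * z i).re) := by
    intro i
    rcases hz.1 i with h | h
    · simp [h]
    · have hc : Continuous (fun ε : ℝ => (((1 : ℂ) + ε * (starRingEnd ℂ t)) * z i).re) := by
        fun_prop
      have : ∀ᶠ ε : ℝ in nhds 0, 0 < (((1 : ℂ) + ε * (starRingEnd ℂ t)) * z i).re := by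
        apply hc.continuousAt.eventually (lt_mem_nhds _)
        simpa using h
      exact (this.filter_mono nhdsWithin_le_nhds).mono (fun _ h => Or.inr h)
  have h2 := Filter.eventually_all.2 h1
  obtain ⟨ε, hε, hε0⟩ := (h2.and self_mem_nhdsWithin).exists
  refine ne_of_rot p hp hD (1 + ε * (starRingEnd ℂ t)) _ ?_ ht
  rw [mul_cons]
  refine inD_cons hε ?_
  have : ((1 + ε * (starRingEnd ℂ t)) * t).re = t.re + ε * Complex.normSq t := by
    simp [Complex.normSq_apply]; ring
  rw [this]
  have : 0 < Complex.normSq t := Complex.normSq_pos.2 ht0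
  have hε0 : 0 < ε := hε0
  positivity

theorem root_real {k d : ℕ} (p : MvPolynomial (Fin (k + 1)) ℂ) (hp : p.IsHomogeneous d)
    (hD : ∀ z, InD z → MvPolynomial.eval z p ≠ 0) (x : Fin k → ℝ) (hx : ∀ i, 0 ≤ x i) (t : ℂ)
    (ht : MvPolynomial.eval (Fin.cons t (fun i => (x i : ℂ)) : Fin (k + 1) → ℂ) p = 0) :
    t.im = 0 := by
  by_contra him
  have hlt : |t.re| < ‖t‖ := Complex.abs_re_lt_norm.2 him
  have hlt' := abs_lt.1 hlt
  refine ne_of_rot p hp hD ((‖t‖ : ℂ) + starRingEnd ℂ t) _ ?_ ht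
  rw [mul_cons]
  refine inD_cons (fun i => ?_) ?_
  · rcases (hx i).eq_or_lt with h | h
    · left; simp [← h]
    · right
      simp
      have : 0 < ‖t‖ + t.re := by linarith [hlt'.1]
      positivity
  · have : (((‖t‖ : ℂ) + starRingEnd ℂ t) * t).re = ‖t‖ * (t.re + ‖t‖) := by
      have := Complex.sq_norm t
      rw [Complex.normSq_apply] at this
      simp
      linarith
    rw [this]
    have h1 : 0 < t.re + ‖t‖ := by linarith [hlt'.1]
    have h2 : 0 < ‖t‖ := (abs_nonneg _).trans_lt hlt
    positivity

/-- univariate slice -/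
noncomputable def slice {k : ℕ} (p : MvPolynomial (Fin (k + 1)) ℂ) (z : Fin k → ℂ) :
    Polynomial ℂ := Polynomial.map (MvPolynomial.eval z) (MvPolynomial.finSuccEquiv ℂ k p)

theorem slice_eval {k : ℕ} (p : MvPolynomial (Fin (k + 1)) ℂ) (z : Fin k → ℂ) (t : ℂ) :
    (slice p z).eval t = MvPolynomial.eval (Fin.cons t z : Fin (k + 1) → ℂ) p :=
  (MvPolynomial.eval_eq_eval_mv_eval' z t p).symm

theorem slice_coeff {k : ℕ} (p : MvPolynomial (Fin (k + 1)) ℂ) (z : Fin k → ℂ) (i : ℕ) :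
    (slice p z).coeff i = MvPolynomial.eval z ((MvPolynomial.finSuccEquiv ℂ k p).coeff i) := by
  simp [slice]

theorem slice_natDegree {k d : ℕ} (p : MvPolynomial (Fin (k + 1)) ℂ) (hp : p.IsHomogeneous d)
    (z : Fin k → ℂ) : (slice p z).natDegree ≤ d := by
  refine Polynomial.natDegree_map_le.trans ?_
  rw [MvPolynomial.natDegree_finSuccEquiv]
  exact (MvPolynomial.degreeOf_le_totalDegree _ _).trans hp.totalDegree_le

theorem slice_nonconst {k d : ℕ} (hd : d ≠ 0) (p : MvPolynomial (Fin (k + 1)) ℂ)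
    (hp : p.IsHomogeneous d)
    (hD : ∀ z, InD z → MvPolynomial.eval z p ≠ 0) (z : Fin k → ℂ) :
    (slice p z).natDegree ≠ 0 := by
  intro h
  obtain ⟨c, hc⟩ := Polynomial.natDegree_eq_zero.1 h
  have hconst : ∀ t : ℂ, MvPolynomial.eval (Fin.cons t z : Fin (k + 1) → ℂ) p = c := by
    intro t; rw [← slice_eval, ← hc, Polynomial.eval_C]
  have hf : Continuous (fun s : ℂ =>
      MvPolynomial.eval (Fin.cons 1 (fun i => s * z i) : Fin (k + 1) → ℂ) p) := by
    refine (MvPolynomial.continuous_eval p).comp ?_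
    refine continuous_pi (fun i => ?_)
    refine Fin.cases ?_ (fun j => ?_) i
    · simpa using continuous_const
    · simp only [Fin.cons_succ]; fun_prop
  have hg : Continuous (fun s : ℂ => s ^ d * c) := by fun_prop
  have := Continuous.ext_on (dense_compl_singleton (0 : ℂ)) hf hg (by
    intro s hs
    have hs : s ≠ 0 := hs
    have h1 := eval_smul_homog p hp s (Fin.cons s⁻¹ z)
    rw [mul_cons, hconst, mul_inv_cancel₀ hs] at h1
    exact h1)
  have h0 := congrFun this 0
  simp only [zero_mul, zero_pow hd] at h0
  exact hD _ (inD_cons (fun i => Or.inl rfl) (by simp)) h0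

theorem coeff_one_ne {k d : ℕ} (hd : d ≠ 0) (p : MvPolynomial (Fin (k + 1)) ℂ)
    (hp : p.IsHomogeneous d)
    (hD : ∀ z, InD z → MvPolynomial.eval z p ≠ 0) (z : Fin k → ℂ) (hz : InD z) :
    MvPolynomial.eval z ((MvPolynomial.finSuccEquiv ℂ k p).coeff 1) ≠ 0 := by
  rw [← slice_coeff]
  set q := slice p z with hq
  have hne : q.eval 0 ≠ 0 := by
    rw [slice_eval]; exact hD _ (inD_cons_zero hz)
  have hq0 : q ≠ 0 := by intro h; rw [h] at hne; simp at hne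
  have hsp : q.Splits := IsAlgClosed.splits q
  have h1 := hsp.eval_derivative_eq_eval_mul_sum hne
  have h2 : q.derivative.eval 0 = q.coeff 1 := by
    rw [← Polynomial.coeff_zero_eq_eval_zero, Polynomial.coeff_derivative]; simp
  rw [← h2, h1]
  refine mul_ne_zero hne (fun h0 => ?_)
  have hpos : ∀ T : Multiset ℂ, (∀ r ∈ T, r.re < 0) → T ≠ 0 →
      0 < ((T.map fun z => 1 / (0 - z)).sum).re := by
    intro T
    induction T using Multiset.induction_on with
    | empty => simp
    | cons a T ih =>
      intro hT _
      have ha := hT a (Multiset.mem_cons_self a T)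
      have h1 : 0 < (1 / (0 - a)).re := by
        have : a ≠ 0 := by rintro rfl; simp at ha
        have := Complex.normSq_pos.2 this
        simp [Complex.inv_re]
        exact div_neg_of_neg_of_pos ha this
      rw [Multiset.map_cons, Multiset.sum_cons, Complex.add_re]
      by_cases hT0 : T = 0
      · simp only [hT0, Multiset.map_zero, Multiset.sum_zero, Complex.zero_re, add_zero]
        exact h1
      · have := ih (fun r hr => hT r (Multiset.mem_cons_of_mem hr)) hT0
        linarith
  have := hpos q.roots (fun r hr => root_re_neg p hp hD z hz r (by
    rw [← slice_eval]; exact (Polynomial.mem_roots hq0).1 hr)) (by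
    intro hr
    apply slice_nonconst hd p hp hD z
    rw [← hq, hsp.natDegree_eq_card_roots, hr, Multiset.card_zero])
  rw [h0] at this
  simp at this

theorem capacity_bound (k : ℕ) : ∀ (p : MvPolynomial (Fin (k + 1)) ℂ),
    p.IsHomogeneous (k + 1) → (∀ z, InD z → MvPolynomial.eval z p ≠ 0) →
    (∀ x : Fin (k + 1) → ℝ, (∀ i, 0 ≤ x i) → x ≠ 0 →
      ∃ r : ℝ, 0 < r ∧ MvPolynomial.eval (fun i => (x i : ℂ)) p = (r : ℂ)) →
    ∀ C : ℝ, (∀ x : Fin (k + 1) → ℝ, (∀ i, 0 < x i) →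
      C * ∏ i, x i ≤ (MvPolynomial.eval (fun i => (x i : ℂ)) p).re) →
    C * ((k + 1).factorial / (k + 1 : ℝ) ^ (k + 1)) ≤
      (MvPolynomial.coeff (Finsupp.equivFunOnFinite.symm (fun _ => 1)) p).re := by
  induction k with
  | zero =>
    intro p hp hD hpos C hC
    have h := hC (fun _ => 1) (fun _ => one_pos)
    have hco : MvPolynomial.eval (fun _ : Fin (0 + 1) => (((1 : ℝ) : ℂ))) p =
        MvPolynomial.coeff (Finsupp.equivFunOnFinite.symm (fun _ => 1)) p := by
      rw [MvPolynomial.eval_eq]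
      simp only [Complex.ofReal_one, one_pow, Finset.prod_const_one, mul_one]
      refine Finset.sum_eq_single _ ?_ ?_
      · intro m hm hne
        exfalso
        apply hne
        have h1 : m.degree = 1 := by
          by_contra hcon
          exact (MvPolynomial.mem_support_iff.1 hm) (hp.coeff_eq_zero hcon)
        rw [Finsupp.degree_eq_sum] at h1
        ext i
        fin_cases i
        simpa using h1
      · intro hm
        exact MvPolynomial.notMem_support_iff.1 hm
    rw [hco] at h
    simpa using h
  | succ k ih =>
    intro p hp hD hpos C hC
    set p1 := (MvPolynomial.finSuccEquiv ℂ (k + 1) p).coeff 1 with hp1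
    have hcoef : MvPolynomial.coeff (Finsupp.equivFunOnFinite.symm (fun _ => 1)) p =
        MvPolynomial.coeff (Finsupp.equivFunOnFinite.symm (fun _ => 1)) p1 := by
      rw [hp1, MvPolynomial.finSuccEquiv_coeff_coeff]
      congr 1
      ext i
      refine Fin.cases ?_ (fun j => ?_) i <;> simp
    rw [hcoef]
    have hD1 : ∀ z, InD z → MvPolynomial.eval z p1 ≠ 0 := fun z hz =>
      coeff_one_ne (by omega) p hp hD z hz
    -- the key univariate information
    have key : ∀ x : Fin (k + 1) → ℝ, (∀ i, 0 ≤ x i) → x ≠ 0 →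
        ∃ q0 σ : ℝ, 0 < q0 ∧ 0 < σ ∧
          MvPolynomial.eval (fun i => (x i : ℂ)) p1 = ((q0 * σ : ℝ) : ℂ) ∧
          ∀ t : ℝ, 0 ≤ t → (MvPolynomial.eval
            (Fin.cons (t : ℂ) (fun i => (x i : ℂ)) : Fin (k + 1 + 1) → ℂ) p).re ≤
            q0 * (1 + t * σ / ((k + 1 + 1 : ℕ) : ℝ)) ^ (k + 1 + 1) := by
      intro x hx hx0
      have hcast : ∀ t : ℝ, (fun i => (((Fin.cons t x : Fin (k + 1 + 1) → ℝ) i : ℝ) : ℂ)) =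
          (Fin.cons (t : ℂ) (fun i => (x i : ℂ)) : Fin (k + 1 + 1) → ℂ) := by
        intro t
        funext i
        refine Fin.cases ?_ (fun j => ?_) i <;> simp
      have hxD : InD (fun i => (x i : ℂ)) := by
        refine ⟨fun i => ?_, fun h => hx0 ?_⟩
        · rcases (hx i).eq_or_lt with h | h
          · left; simp [← h]
          · right; simpa using h
        · funext i
          have := congrFun h i
          simpa using this
      obtain ⟨q0, hq0, hq0e⟩ := hpos (Fin.cons 0 x) (by
        intro i
        refine Fin.cases ?_ (fun j => ?_) i
        · simp
        · simpa using hx j) (by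
        intro h
        apply hx0
        funext j
        have := congrFun h j.succ
        simpa using this)
      rw [hcast, Complex.ofReal_zero, ← slice_eval] at hq0e
      obtain ⟨σ, hσ, hσ1, hσ2⟩ := uni_bound (slice p (fun i => (x i : ℂ))) (k + 1 + 1) (by omega)
        (slice_natDegree p hp _) q0 hq0 hq0e (by
          intro r hr
          rw [slice_eval] at hr
          exact ⟨root_re_neg p hp hD _ hxD r hr, root_real p hp hD x hx r hr⟩)
      rw [slice_coeff] at hσ1
      refine ⟨q0, σ, hq0, ?_, hσ1, ?_⟩
      · refine lt_of_le_of_ne hσ (fun h => hD1 _ hxD ?_)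
        rw [hσ1, ← h]; simp
      · intro t ht
        rw [← slice_eval]
        exact hσ2 t ht
    have hC1 := ih p1 (hp.finSuccEquiv_coeff_isHomogeneous 1 (k + 1) (by omega)) hD1 (by
      intro x hx hx0
      obtain ⟨q0, σ, h1, h2, h3, -⟩ := key x hx hx0
      exact ⟨q0 * σ, mul_pos h1 h2, h3⟩) (C * ((k + 1 : ℝ) / (k + 2)) ^ (k + 1)) (by
      intro x hx
      obtain ⟨q0, σ, h1, h2, h3, h4⟩ := key x (fun i => (hx i).le) (by
        intro h
        have := hx 0
        rw [h] at this
        simp at this)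
      rw [h3, Complex.ofReal_re]
      set t : ℝ := (k + 2) / ((k + 1) * σ) with ht
      have ht0 : 0 < t := by positivity
      have h5 := h4 t ht0.le
      have h6 := hC (Fin.cons t x) (by
        intro i
        refine Fin.cases ?_ (fun j => ?_) i
        · simpa using ht0
        · simpa using hx j)
      have hcast : (fun i => (((Fin.cons t x : Fin (k + 1 + 1) → ℝ) i : ℝ) : ℂ)) =
          (Fin.cons (t : ℂ) (fun i => (x i : ℂ)) : Fin (k + 1 + 1) → ℂ) := by
        funext i
        refine Fin.cases ?_ (fun j => ?_) i <;> simp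
      rw [hcast, Fin.prod_univ_succ] at h6
      simp only [Fin.cons_zero, Fin.cons_succ] at h6
      have h7 := h6.trans h5
      have h8 : 1 + t * σ / ((k + 1 + 1 : ℕ) : ℝ) = (k + 2) / (k + 1) := by
        rw [ht]; push_cast; field_simp; ring
      rw [h8] at h7
      set P := ∏ i, x i with hP
      set a : ℝ := (k : ℝ) + 1 with ha
      set b : ℝ := (k : ℝ) + 2 with hb
      have hapos : 0 < a := by positivity
      have hbpos : 0 < b := by positivity
      have h9 : C * (t * P) * (σ * (a / b) ^ (k + 1 + 1)) ≤
          q0 * (b / a) ^ (k + 1 + 1) * (σ * (a / b) ^ (k + 1 + 1)) :=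
        mul_le_mul_of_nonneg_right h7 (by positivity)
      have h10 : q0 * (b / a) ^ (k + 1 + 1) * (σ * (a / b) ^ (k + 1 + 1)) = q0 * σ := by
        have : (b / a) ^ (k + 1 + 1) * (a / b) ^ (k + 1 + 1) = 1 := by
          rw [← mul_pow]
          have : b / a * (a / b) = 1 := by field_simp
          rw [this, one_pow]
        linear_combination q0 * σ * this
      have h11 : C * (t * P) * (σ * (a / b) ^ (k + 1 + 1)) = C * (a / b) ^ (k + 1) * P := by
        rw [pow_succ, ht]
        field_simp
      rw [h10, h11] at h9
      exact h9)
    refine le_trans (le_of_eq ?_) hC1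
    rw [Nat.factorial_succ (k + 1)]
    push_cast
    have e : (k : ℝ) + 1 + 1 = k + 2 := by ring
    rw [e, div_pow, pow_succ ((k : ℝ) + 2)]
    field_simp

/-- The product polynomial of a matrix. -/
noncomputable def prodPoly {n : ℕ} (A : Matrix (Fin n) (Fin n) ℝ) : MvPolynomial (Fin n) ℂ :=
  ∏ i, ∑ j, MvPolynomial.C (A i j : ℂ) * MvPolynomial.X j

theorem prodPoly_homog {n : ℕ} (A : Matrix (Fin n) (Fin n) ℝ) :
    (prodPoly A).IsHomogeneous n := by
  have := MvPolynomial.IsHomogeneous.prod Finset.univ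
    (fun i => ∑ j, MvPolynomial.C (A i j : ℂ) * MvPolynomial.X j) (fun _ => 1)
    (fun i _ => MvPolynomial.IsHomogeneous.sum _ _ _
      (fun j _ => MvPolynomial.isHomogeneous_C_mul_X _ _))
  simpa [prodPoly] using this

theorem prodPoly_eval {n : ℕ} (A : Matrix (Fin n) (Fin n) ℝ) (z : Fin n → ℂ) :
    MvPolynomial.eval z (prodPoly A) = ∏ i, ∑ j, (A i j : ℂ) * z j := by
  simp [prodPoly, MvPolynomial.eval_prod]

theorem prod_X_eq {n : ℕ} (s : Finset (Fin n)) (f : Fin n → Fin n) (a : Fin n → ℂ) :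
    ∏ i ∈ s, (MvPolynomial.C (a i) * MvPolynomial.X (f i) : MvPolynomial (Fin n) ℂ) =
      MvPolynomial.monomial (∑ i ∈ s, Finsupp.single (f i) 1) (∏ i ∈ s, a i) := by
  classical
  induction s using Finset.induction_on with
  | empty => simp
  | insert b s hb ih =>
    rw [Finset.prod_insert hb, Finset.sum_insert hb, Finset.prod_insert hb, ih,
      MvPolynomial.C_mul_X_eq_monomial, MvPolynomial.monomial_mul]

theorem sum_perm_eq {n : ℕ} {M : Type*} [AddCommMonoid M] (g : (Fin n → Fin n) → M) :
    ∑ f : Fin n → Fin n, (if Function.Bijective f then g f else 0) =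
      ∑ σ : Equiv.Perm (Fin n), g σ := by
  classical
  rw [← Finset.sum_filter]
  symm
  refine Finset.sum_bij (fun σ _ => (σ : Fin n → Fin n)) ?_ ?_ ?_ ?_
  · intro σ _
    exact Finset.mem_filter.2 ⟨Finset.mem_univ _, σ.bijective⟩
  · intro σ _ τ _ h
    exact DFunLike.coe_injective h
  · intro f hf
    exact ⟨Equiv.ofBijective f (Finset.mem_filter.1 hf).2, Finset.mem_univ _, rfl⟩
  · intro σ _; rfl

theorem prodPoly_coeff {n : ℕ} (A : Matrix (Fin n) (Fin n) ℝ) :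
    MvPolynomial.coeff (Finsupp.equivFunOnFinite.symm (fun _ => 1)) (prodPoly A) =
      ((perm A : ℝ) : ℂ) := by
  classical
  rw [prodPoly, Finset.prod_univ_sum]
  simp only [Fintype.piFinset_univ]
  rw [MvPolynomial.coeff_sum, perm]
  push_cast
  rw [← sum_perm_eq (fun f => ∏ i, (A i (f i) : ℂ))]
  refine Finset.sum_congr rfl (fun f _ => ?_)
  rw [prod_X_eq Finset.univ f (fun i => (A i (f i) : ℂ)), MvPolynomial.coeff_monomial]
  refine if_congr ?_ rfl rfl
  have hval : ∀ j, (∑ i, Finsupp.single (f i) 1 : Fin n →₀ ℕ) j =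
      (Finset.univ.filter (fun i => f i = j)).card := by
    intro j
    rw [Finsupp.finsetSum_apply, Finset.card_filter]
    refine Finset.sum_congr rfl (fun i _ => ?_)
    rw [Finsupp.single_apply]
  constructor
  · intro h
    rw [← Finite.surjective_iff_bijective]
    intro j
    have h1 := hval j
    rw [h] at h1
    simp only [Finsupp.equivFunOnFinite_symm_apply_apply] at h1
    obtain ⟨i, hi⟩ := Finset.card_pos.1 (by rw [← h1]; exact one_pos)
    exact ⟨i, (Finset.mem_filter.1 hi).2⟩
  · intro h
    ext j
    rw [hval]
    simp only [Finsupp.equivFunOnFinite_symm_apply_apply]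
    obtain ⟨i, hi⟩ := h.2 j
    rw [Finset.card_eq_one]
    refine ⟨i, ?_⟩
    ext l
    simp only [Finset.mem_filter, Finset.mem_univ, true_and, Finset.mem_singleton]
    constructor
    · intro hl; exact h.1 (hl.trans hi.symm)
    · rintro rfl; exact hi

theorem perm_nonneg {n : ℕ} (A : Matrix (Fin n) (Fin n) ℝ) (hA : ∀ i j, 0 ≤ A i j) :
    0 ≤ perm A :=
  Finset.sum_nonneg (fun σ _ => Finset.prod_nonneg (fun i _ => hA _ _))

theorem perm_lower {n : ℕ} (hn : 0 < n) (A : Matrix (Fin n) (Fin n) ℝ)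
    (hA : ∀ i j, 0 < A i j) (C : ℝ)
    (hC : ∀ y : Fin n → ℝ, (∀ j, 0 < y j) → C * ∏ j, y j ≤ ∏ i, ∑ j, A i j * y j) :
    C * (n.factorial / (n : ℝ) ^ n) ≤ perm A := by
  obtain ⟨k, rfl⟩ : ∃ k, n = k + 1 := ⟨n - 1, by omega⟩
  have hreal : ∀ x : Fin (k + 1) → ℝ, MvPolynomial.eval (fun i => (x i : ℂ)) (prodPoly A) =
      ((∏ i, ∑ j, A i j * x j : ℝ) : ℂ) := by
    intro x
    rw [prodPoly_eval]
    push_cast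
    rfl
  have h := capacity_bound k (prodPoly A) (prodPoly_homog A) (by
    intro z hz
    rw [prodPoly_eval]
    refine Finset.prod_ne_zero_iff.2 (fun i _ h0 => hz.2 ?_)
    have h1 : ∑ j, A i j * (z j).re = 0 := by
      have := congrArg Complex.re h0
      simpa using this
    have hnn : ∀ j, 0 ≤ (z j).re := by
      intro j
      rcases hz.1 j with h | h
      · simp [h]
      · exact h.le
    rw [Finset.sum_eq_zero_iff_of_nonneg (fun j _ => mul_nonneg (hA i j).le (hnn j))] at h1
    funext j
    have h2 := h1 j (Finset.mem_univ j)
    rcases hz.1 j with h | h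
    · simpa using h
    · exact absurd h2 (mul_pos (hA i j) h).ne') (by
    intro x hx hx0
    refine ⟨_, ?_, hreal x⟩
    refine Finset.prod_pos (fun i _ => ?_)
    obtain ⟨j, hj⟩ := Function.ne_iff.1 hx0
    refine Finset.sum_pos' (fun j _ => mul_nonneg (hA i j).le (hx j)) ⟨j, Finset.mem_univ j, ?_⟩
    exact mul_pos (hA i j) (lt_of_le_of_ne (hx j) (Ne.symm hj))) C (by
    intro x hx
    rw [hreal, Complex.ofReal_re]
    exact hC x hx)
  rw [prodPoly_coeff, Complex.ofReal_re] at h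
  exact_mod_cast h

theorem perm_le_prod {n : ℕ} (A : Matrix (Fin n) (Fin n) ℝ) (hA : ∀ i j, 0 ≤ A i j) :
    perm A ≤ ∏ i, ∑ j, A i j := by
  classical
  rw [Finset.prod_univ_sum (fun _ => Finset.univ) (fun i j => A i j)]
  simp only [Fintype.piFinset_univ]
  rw [perm, ← sum_perm_eq (fun f => ∏ i, A i (f i))]
  refine Finset.sum_le_sum (fun f _ => ?_)
  split_ifs
  · exact le_rfl
  · exact Finset.prod_nonneg (fun i _ => hA _ _)

theorem gmVec_pos {n : ℕ} (v : Fin n → ℝ) (hv : ∀ i, 0 < v i) : 0 < gmVec v :=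
  Real.rpow_pos_of_pos (Finset.prod_pos (fun i _ => hv i)) _

theorem gmVec_pow {n : ℕ} (hn : 0 < n) (v : Fin n → ℝ) (hv : ∀ i, 0 < v i) :
    gmVec v ^ n = ∏ i, v i := by
  rw [gmVec, Fintype.card_fin]
  exact Real.rpow_inv_natCast_pow (Finset.prod_nonneg (fun i _ => (hv i).le)) hn.ne'

theorem smSet_nonneg {n : ℕ} (A : Matrix (Fin n) (Fin n) ℝ) (hA : ∀ i j, 0 ≤ A i j) :
    ∀ r ∈ smSet A, 0 ≤ r := by
  rintro r ⟨x, y, hx, hy, rfl⟩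
  have h1 := gmVec_pos x hx
  have h2 := gmVec_pos y hy
  refine div_nonneg (Finset.sum_nonneg (fun i _ => Finset.sum_nonneg (fun j _ => ?_)))
    (by positivity)
  exact mul_nonneg (mul_nonneg (hx i).le (hA i j)) (hy j).le

theorem smSet_nonempty {n : ℕ} (A : Matrix (Fin n) (Fin n) ℝ) : (smSet A).Nonempty :=
  ⟨_, fun _ => 1, fun _ => 1, fun _ => one_pos, fun _ => one_pos, rfl⟩

theorem perm_le_of_mem {n : ℕ} (hn : 0 < n) (A : Matrix (Fin n) (Fin n) ℝ)
    (hA : ∀ i j, 0 ≤ A i j) (r : ℝ) (hr : r ∈ smSet A) :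
    perm A ≤ (r / n) ^ n := by
  have hr0 := smSet_nonneg A hA r hr
  obtain ⟨x, y, hx, hy, hre⟩ := hr
  have h1 := gmVec_pos x hx
  have h2 := gmVec_pos y hy
  set S := ∑ i, ∑ j, x i * A i j * y j with hS
  have hB : ∀ i j, 0 ≤ x i * A i j * y j := fun i j =>
    mul_nonneg (mul_nonneg (hx i).le (hA i j)) (hy j).le
  have hS0 : 0 ≤ S := Finset.sum_nonneg (fun i _ => Finset.sum_nonneg (fun j _ => hB i j))
  have hperm : perm (Matrix.of fun i j => x i * A i j * y j) =
      perm A * ((∏ i, x i) * ∏ j, y j) := by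
    rw [perm, perm, Finset.sum_mul]
    refine Finset.sum_congr rfl (fun σ _ => ?_)
    simp only [Matrix.of_apply, Finset.prod_mul_distrib]
    rw [Equiv.prod_comp σ y]
    ring
  have h3 := perm_le_prod (Matrix.of fun i j => x i * A i j * y j) hB
  rw [hperm] at h3
  simp only [Matrix.of_apply] at h3
  have hn' : (0 : ℝ) < n := by exact_mod_cast hn
  have h4 : ∏ i, ∑ j, x i * A i j * y j ≤ (S / n) ^ n := by
    rcases hS0.eq_or_lt with h | h
    · have hz : ∀ i, ∑ j, x i * A i j * y j = 0 := by
        intro i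
        exact (Finset.sum_eq_zero_iff_of_nonneg
          (fun i _ => Finset.sum_nonneg (fun j _ => hB i j))).1 h.symm i (Finset.mem_univ i)
      rw [← h, Finset.prod_eq_zero (Finset.mem_univ (⟨0, hn⟩ : Fin n)) (hz _)]
      simp [hn.ne']
    · have := multiset_amgm (Finset.univ.val.map (fun i => ∑ j, x i * A i j * y j)) (by
        intro a ha
        obtain ⟨i, -, rfl⟩ := Multiset.mem_map.1 ha
        exact Finset.sum_nonneg (fun j _ => hB i j)) (S / n) (by positivity) (by
        simp only [Multiset.card_map, Finset.card_val, Finset.card_univ, Fintype.card_fin]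
        rw [mul_div_cancel₀ _ hn'.ne']
        rfl)
      simp only [Multiset.card_map, Finset.card_val, Finset.card_univ, Fintype.card_fin] at this
      exact this
  have h5 := h3.trans h4
  have hg : (∏ i, x i) * ∏ j, y j = (gmVec x * gmVec y) ^ n := by
    rw [mul_pow, gmVec_pow hn x hx, gmVec_pow hn y hy]
  rw [hg] at h5
  have hS' : S = r * (gmVec x * gmVec y) := by
    rw [hre]; field_simp
  rw [hS'] at h5
  have h6 : (r * (gmVec x * gmVec y) / n) ^ n = (r / n) ^ n * (gmVec x * gmVec y) ^ n := by
    rw [← mul_pow]; congr 1; ring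
  rw [h6] at h5
  exact le_of_mul_le_mul_right h5 (by positivity)

theorem sm_le_pm_pos {n : ℕ} (hn : 0 < n) (A : Matrix (Fin n) (Fin n) ℝ)
    (hA : ∀ i j, 0 < A i j) : sm A ≤ pm A := by
  have hn' : (0 : ℝ) < n := by exact_mod_cast hn
  have hnn := smSet_nonneg A (fun i j => (hA i j).le)
  have hbdd : BddBelow (smSet A) := ⟨0, hnn⟩
  set s := sInf (smSet A) with hs
  have hs0 : 0 ≤ s := Real.sInf_nonneg hnn
  have h := perm_lower hn A hA ((s / n) ^ n) (by
    intro y hy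
    have hrow : ∀ i, 0 < ∑ j, A i j * y j := fun i =>
      Finset.sum_pos (fun j _ => mul_pos (hA i j) (hy j)) ⟨i, Finset.mem_univ i⟩
    set x : Fin n → ℝ := fun i => (∑ j, A i j * y j)⁻¹ with hx
    have hx0 : ∀ i, 0 < x i := fun i => inv_pos.2 (hrow i)
    have hsum : ∑ i, ∑ j, x i * A i j * y j = n := by
      have : ∀ i, ∑ j, x i * A i j * y j = 1 := by
        intro i
        simp only [mul_assoc]
        rw [← Finset.mul_sum]
        exact inv_mul_cancel₀ (hrow i).ne'
      simp [this]
    have hle : s ≤ n / (gmVec x * gmVec y) :=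
      csInf_le hbdd ⟨x, y, hx0, hy, by rw [hsum]⟩
    have h1 := gmVec_pos x hx0
    have h2 := gmVec_pos y hy
    rw [le_div_iff₀ (by positivity)] at hle
    have h3 : s / n * (gmVec x * gmVec y) ≤ 1 := by
      rw [div_mul_eq_mul_div, div_le_one hn']; exact hle
    have h4 : (s / n * (gmVec x * gmVec y)) ^ n ≤ 1 := pow_le_one₀ (by positivity) h3
    rw [mul_pow, mul_pow, gmVec_pow hn x hx0, gmVec_pow hn y hy, hx, Finset.prod_inv_distrib] at h4
    have hP : 0 < ∏ i, ∑ j, A i j * y j := Finset.prod_pos (fun i _ => hrow i)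
    calc (s / n) ^ n * ∏ j, y j = ((s / n) ^ n * ((∏ i, ∑ j, A i j * y j)⁻¹ * ∏ j, y j)) *
          ∏ i, ∑ j, A i j * y j := by field_simp
      _ ≤ 1 * ∏ i, ∑ j, A i j * y j := mul_le_mul_of_nonneg_right h4 hP.le
      _ = _ := one_mul _)
  have hf : (0 : ℝ) < n.factorial := by exact_mod_cast Nat.factorial_pos n
  have h2 : (((n : ℝ) * n)⁻¹ * s) ^ n ≤ perm A / n.factorial := by
    rw [le_div_iff₀ hf]
    refine le_trans (le_of_eq ?_) h
    rw [mul_pow, inv_pow, mul_pow, div_pow]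
    field_simp
  rw [sm, pm, Fintype.card_fin, ← hs]
  calc ((n : ℝ) * n)⁻¹ * s = ((((n : ℝ) * n)⁻¹ * s) ^ n) ^ ((n : ℝ)⁻¹) :=
        (Real.pow_rpow_inv_natCast (by positivity) hn.ne').symm
    _ ≤ _ := Real.rpow_le_rpow (by positivity) h2 (by positivity)

theorem sm_mono {n : ℕ} (A B : Matrix (Fin n) (Fin n) ℝ) (hA : ∀ i j, 0 ≤ A i j)
    (hAB : ∀ i j, A i j ≤ B i j) : sm A ≤ sm B := by
  rw [sm, sm]
  refine mul_le_mul_of_nonneg_left ?_ (by positivity)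
  refine le_csInf (smSet_nonempty B) ?_
  rintro r ⟨x, y, hx, hy, rfl⟩
  refine (csInf_le ⟨0, smSet_nonneg A hA⟩ ⟨x, y, hx, hy, rfl⟩).trans ?_
  have h1 := gmVec_pos x hx
  have h2 := gmVec_pos y hy
  refine div_le_div_of_nonneg_right ?_ (by positivity)
  refine Finset.sum_le_sum (fun i _ => Finset.sum_le_sum (fun j _ => ?_))
  exact mul_le_mul_of_nonneg_right (mul_le_mul_of_nonneg_left (hAB i j) (hx i).le) (hy j).le

theorem sm_le_pm {n : ℕ} (hn : 0 < n) (A : Matrix (Fin n) (Fin n) ℝ)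
    (hA : ∀ i j, 0 ≤ A i j) : sm A ≤ pm A := by
  have hc : Continuous (fun ε : ℝ => pm (Matrix.of fun i j => A i j + ε)) := by
    unfold pm perm
    refine Continuous.rpow_const ?_ (fun _ => Or.inr (by positivity))
    simp only [Matrix.of_apply]
    fun_prop
  have hlim : Filter.Tendsto (fun ε : ℝ => pm (Matrix.of fun i j => A i j + ε))
      (nhdsWithin 0 (Set.Ioi 0)) (nhds (pm A)) := by
    have h := (hc.tendsto 0).mono_left (nhdsWithin_le_nhds (s := Set.Ioi 0))
    have e : (Matrix.of fun i j => A i j + 0) = A := by ext; simp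
    rw [e] at h
    exact h
  refine ge_of_tendsto hlim ?_
  filter_upwards [self_mem_nhdsWithin] with ε hε
  have hε : 0 < ε := hε
  refine (sm_mono A (Matrix.of fun i j => A i j + ε) hA ?_).trans (sm_le_pm_pos hn _ ?_)
  · intro i j; simp [hε.le]
  · intro i j
    have := hA i j
    simp only [Matrix.of_apply]
    positivity

theorem pm_le_sm {n : ℕ} (hn : 0 < n) (A : Matrix (Fin n) (Fin n) ℝ)
    (hA : ∀ i j, 0 ≤ A i j) :
    pm A ≤ (n : ℝ) * ((Nat.factorial n : ℝ) ^ (-(n : ℝ)⁻¹)) * sm A := by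
  have hn' : (0 : ℝ) < n := by exact_mod_cast hn
  have hp := perm_nonneg A hA
  have hf : (0 : ℝ) < n.factorial := by exact_mod_cast Nat.factorial_pos n
  have h1 : (n : ℝ) * perm A ^ ((n : ℝ)⁻¹) ≤ sInf (smSet A) := by
    refine le_csInf (smSet_nonempty A) (fun r hr => ?_)
    have hr0 := smSet_nonneg A hA r hr
    have h2 := Real.rpow_le_rpow hp (perm_le_of_mem hn A hA r hr)
      (show (0 : ℝ) ≤ (n : ℝ)⁻¹ by positivity)
    rw [Real.pow_rpow_inv_natCast (by positivity) hn.ne', le_div_iff₀ hn'] at h2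
    linarith
  rw [pm, sm, Fintype.card_fin, Real.div_rpow hp hf.le, Real.rpow_neg hf.le]
  have hF : 0 < (n.factorial : ℝ) ^ ((n : ℝ)⁻¹) := Real.rpow_pos_of_pos hf _
  set F := (n.factorial : ℝ) ^ ((n : ℝ)⁻¹)
  have h3 : (n : ℝ) * F⁻¹ * (((n : ℝ) * n)⁻¹ * sInf (smSet A)) = (sInf (smSet A) / n) / F := by
    field_simp
  rw [h3]
  refine div_le_div_of_nonneg_right ?_ hF.le
  rw [le_div_iff₀ hn']
  linarith

/-- Generalized van der Waerden bounds:
`sm(A) ≤ pm(A) ≤ n·(n!)^{-1/n}·sm(A)` for every nonnegative `n × n` matrix. -/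
theorem stmt_1 {n : ℕ} (hn : 0 < n) (A : Matrix (Fin n) (Fin n) ℝ)
    (hA : ∀ i j, 0 ≤ A i j) :
    sm A ≤ pm A ∧
      pm A ≤ (n : ℝ) * ((Nat.factorial n : ℝ) ^ (-(n : ℝ)⁻¹)) * sm A := by
  exact ⟨sm_le_pm hn A hA, pm_le_sm hn A hA⟩
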